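/- Let G be a finite group containing a nontrivial cyclic subgroup H with |G| ≤ |H|². Then H contains a nontrivial subgroup that is normal in G. -/

import Mathlib

namespace LucchiniAux

universe u

lemma isPGroup_zpowers {G : Type*} [Group G] {p : ℕ} (x : G)
    (hx : orderOf x = p) : IsPGroup p (Subgroup.zpowers x) :=
  IsPGroup.of_card (n := 1) (by rw [Nat.card_zpowers, hx, pow_one])

lemma exists_normalizing {G : Type*} [Group G] [Finite G] {p : ℕ} [Fact p.Prime]
    (P E : Subgroup G) (hP : IsPGroup p P) (hE : E < P) :
    ∃ x ∈ P, x ∉ E ∧ x ∈ Subgroup.normalizer (E : Set G) := by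
  have := hP.isNilpotent
  have hlt : E.subgroupOf P < ⊤ := by
    rw [lt_top_iff_ne_top, Ne, Subgroup.subgroupOf_eq_top]
    exact fun h => absurd hE (not_lt_of_ge h)
  have h2 := Group.normalizerCondition_of_isNilpotent (G := P) (E.subgroupOf P) hlt
  obtain ⟨x, hx, hxE⟩ := SetLike.exists_of_lt h2
  refine ⟨x, x.2, fun h => hxE h, ?_⟩
  rw [← Subgroup.subgroupOf_normalizer_eq hE.le] at hx
  exact hx

lemma baer_step {G : Type*} [Group G] [Finite G] {p : ℕ} [Fact p.Prime]
    (P D : Subgroup G) (hP : IsPGroup p P) (K : Set G)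
    (hK : ∀ g k, k ∈ K → g * k * g⁻¹ ∈ K)
    (hDP : D ≤ P) (hD : D = Subgroup.closure (K ∩ D)) (hk : ∃ k ∈ K, k ∈ P ∧ k ∉ D) :
    ∃ x ∈ K, x ∈ P ∧ x ∉ D ∧ x ∈ Subgroup.normalizer (D : Set G) := by
  obtain ⟨E, hE⟩ := Set.Finite.exists_maximal
    (s := {E : Subgroup G | D ≤ E ∧ E ≤ P ∧ ∀ k ∈ K, k ∈ E → k ∈ D}) (Set.toFinite _)
    ⟨D, le_rfl, hDP, fun _ _ h => h⟩
  obtain ⟨⟨hDE, hEP, hKE⟩, hmax⟩ := hE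
  have hlt : E < P := by
    refine lt_of_le_of_ne hEP ?_
    rintro rfl
    obtain ⟨k, hk, hkE, hkD⟩ := hk
    exact hkD (hKE k hk hkE)
  obtain ⟨x, hxP, hxE, hxN⟩ := exists_normalizing P E hP hlt
  have hnot : ¬ (∀ k ∈ K, k ∈ Subgroup.normalizer (E : Set G) ⊓ P → k ∈ D) := by
    intro h
    have := hmax (y := Subgroup.normalizer (E : Set G) ⊓ P)
      ⟨hDE.trans (le_inf Subgroup.le_normalizer hEP), inf_le_right, h⟩
      (le_inf Subgroup.le_normalizer hEP)
    exact hxE (this ⟨hxN, hxP⟩)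
  push Not at hnot
  obtain ⟨y, hyK, ⟨hyN, hyP⟩, hyD⟩ := hnot
  refine ⟨y, hyK, hyP, hyD, ?_⟩
  have key : ∀ z, z ∈ K ∩ (D : Set G) ↔ y * z * y⁻¹ ∈ K ∩ (D : Set G) := by
    intro z
    have hyN' := Subgroup.mem_normalizer_iff.1 hyN z
    constructor
    · rintro ⟨h1, h2⟩
      exact ⟨hK _ _ h1, hKE _ (hK _ _ h1) (hyN'.1 (hDE h2))⟩
    · rintro ⟨h1, h2⟩
      have h3 : z ∈ K := by
        have := hK y⁻¹ _ h1
        simpa [mul_assoc] using this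
      exact ⟨h3, hKE _ h3 (hyN'.2 (hDE h2))⟩
  have h1 : y ∈ Subgroup.normalizer (K ∩ (D : Set G)) := Subgroup.mem_set_normalizer_iff.2 key
  have h2 := Subgroup.normalizer_le_normalizer_closure _ h1
  rwa [← hD] at h2

lemma baer {G : Type*} [Group G] [Finite G] {p : ℕ} [Fact p.Prime] (x : G)
    (h : ∀ g : G, ∃ S : Subgroup G, IsPGroup p S ∧ x ∈ S ∧ g * x * g⁻¹ ∈ S) :
    ∃ N : Subgroup G, N.Normal ∧ IsPGroup p N ∧ x ∈ N := by
  set K : Set G := Set.range (fun g : G => g * x * g⁻¹) with hKdef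
  have hxK : x ∈ K := ⟨1, by simp⟩
  have hK : ∀ g k, k ∈ K → g * k * g⁻¹ ∈ K := by
    rintro g _ ⟨a, rfl⟩
    exact ⟨g * a, by simp [mul_assoc]⟩
  have hpair : ∀ u ∈ K, ∀ v ∈ K, ∃ S : Subgroup G, IsPGroup p S ∧ u ∈ S ∧ v ∈ S := by
    rintro _ ⟨a, rfl⟩ _ ⟨b, rfl⟩
    obtain ⟨S, hS, h1, h2⟩ := h (a⁻¹ * b)
    refine ⟨S.map (MulAut.conj a).toMonoidHom, hS.map _, ⟨x, h1, by simp⟩, ⟨_, h2, ?_⟩⟩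
    simp [mul_assoc]
  by_cases hall : ∀ P Q : Sylow p G, K ∩ P = K ∩ Q
  · obtain ⟨P⟩ : Nonempty (Sylow p G) := inferInstance
    have hKP : K ⊆ (P : Set G) := by
      intro k hk
      obtain ⟨S, hS, h1, -⟩ := hpair k hk k hk
      obtain ⟨Q, hQ⟩ := hS.exists_le_sylow
      have : k ∈ K ∩ (Q : Set G) := ⟨hk, hQ h1⟩
      rw [hall Q P] at this
      exact this.2
    refine ⟨Subgroup.normalClosure {x}, inferInstance, ?_, Subgroup.subset_normalClosure rfl⟩
    refine P.isPGroup'.to_le ?_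
    unfold Subgroup.normalClosure
    rw [Subgroup.closure_le]
    intro k hk
    obtain ⟨y, hy, hyk⟩ := Group.mem_conjugatesOfSet_iff.1 hk
    rw [Set.mem_singleton_iff] at hy
    subst hy
    obtain ⟨c, hc⟩ := isConj_iff.1 hyk
    exact hKP ⟨c, hc⟩
  · exfalso
    push Not at hall
    obtain ⟨P0, Q0, h0⟩ := hall
    obtain ⟨⟨P, Q⟩, hPQ, hmax⟩ := Set.exists_max_image
      {PQ : Sylow p G × Sylow p G | K ∩ PQ.1 ≠ K ∩ PQ.2}
      (fun PQ => (K ∩ PQ.1 ∩ PQ.2 : Set G).ncard) (Set.toFinite _) ⟨(P0, Q0), h0⟩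
    simp only [Set.mem_ofPred_eq, Prod.forall] at hPQ hmax
    have hcard : ∀ P Q : Sylow p G, (K ∩ P : Set G).ncard ≤ (K ∩ Q : Set G).ncard := by
      intro P Q
      obtain ⟨g, rfl⟩ := MulAction.exists_smul_eq G P Q
      refine Set.ncard_le_ncard_of_injOn (fun y => g * y * g⁻¹) ?_ ?_ (Set.toFinite _)
      · rintro y ⟨h1, h2⟩
        refine ⟨hK _ _ h1, ?_⟩
        exact Subgroup.smul_mem_pointwise_smul y (MulAut.conj g) P.1 h2
      · intro a _ b _ hab
        simpa using hab
    have hnsub : ∀ P Q : Sylow p G, K ∩ P ≠ K ∩ Q → ∃ k ∈ K, k ∈ P ∧ k ∉ Q := by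
      intro P Q hne
      by_contra hcon
      push Not at hcon
      apply hne
      exact Set.eq_of_subset_of_ncard_le (fun k hk => ⟨hk.1, hcon k hk.1 hk.2⟩) (hcard Q P)
        (Set.toFinite _)
    set D : Subgroup G := Subgroup.closure (K ∩ P ∩ Q) with hDdef
    have hDP : D ≤ P := (Subgroup.closure_le _).2 fun k hk => hk.1.2
    have hDQ : D ≤ Q := (Subgroup.closure_le _).2 fun k hk => hk.2
    have hKD : K ∩ (D : Set G) = K ∩ P ∩ Q := by
      ext k
      exact ⟨fun hk => ⟨⟨hk.1, hDP hk.2⟩, hDQ hk.2⟩, fun hk => ⟨hk.1.1, Subgroup.subset_closure hk⟩⟩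
    have hD : D = Subgroup.closure (K ∩ D) := by rw [hKD]
    obtain ⟨a, haK, haP, haD, haN⟩ := baer_step P D P.isPGroup' K hK hDP hD (by
      obtain ⟨k, h1, h2, h3⟩ := hnsub P Q hPQ
      exact ⟨k, h1, h2, fun h => h3 (hDQ h)⟩)
    obtain ⟨b, hbK, hbQ, hbD, hbN⟩ := baer_step Q D Q.isPGroup' K hK hDQ hD (by
      obtain ⟨k, h1, h2, h3⟩ := hnsub Q P hPQ.symm
      exact ⟨k, h1, h2, fun h => h3 (hDP h)⟩)
    obtain ⟨S, hS, haS, hbS⟩ := hpair a haK b hbK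
    have hT : IsPGroup p (S ⊓ Subgroup.normalizer (D : Set G) : Subgroup G) := hS.to_le inf_le_left
    have hU := hT.to_sup_of_normal_right' (P.isPGroup'.to_le hDP) inf_le_right
    obtain ⟨R, hR⟩ := hU.exists_le_sylow
    have haR : a ∈ R := hR (Subgroup.mem_sup_left ⟨haS, haN⟩)
    have hbR : b ∈ R := hR (Subgroup.mem_sup_left ⟨hbS, hbN⟩)
    have hDR : D ≤ R := le_sup_right.trans hR
    have e1 : K ∩ P = K ∩ R := by
      by_contra hne
      have := hmax P R hne
      refine absurd this (not_le_of_gt (Set.ncard_lt_ncard ?_ (Set.toFinite _)))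
      refine ⟨fun k hk => ⟨hk.1, hDR (Subgroup.subset_closure hk)⟩, fun hsub => ?_⟩
      exact haD (Subgroup.subset_closure (hsub ⟨⟨haK, haP⟩, haR⟩))
    have e2 : K ∩ R = K ∩ Q := by
      by_contra hne
      have := hmax R Q hne
      refine absurd this (not_le_of_gt (Set.ncard_lt_ncard ?_ (Set.toFinite _)))
      refine ⟨fun k hk => ⟨⟨hk.1.1, hDR (Subgroup.subset_closure hk)⟩, hk.2⟩, fun hsub => ?_⟩
      exact hbD (Subgroup.subset_closure (hsub ⟨⟨hbK, hbR⟩, hbQ⟩))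
    exact hPQ (e1.trans e2)

theorem zenkov_aux (n : ℕ) : ∀ (G : Type u) [Group G] [Finite G], Nat.card G = n →
    ∀ (p : ℕ) [Fact p.Prime] (A B : Subgroup G) (x : G),
    (∀ a ∈ A, ∀ b ∈ A, a * b = b * a) → (∀ a ∈ B, ∀ b ∈ B, a * b = b * a) →
    x ∈ A → x ∈ B → orderOf x = p →
    (∀ g : G, (∀ y ∈ A, g⁻¹ * y * g ∈ B → y ∈ B) → ∀ y ∈ A, y ∈ B → g⁻¹ * y * g ∈ B) →
    ∃ N : Subgroup G, N.Normal ∧ IsPGroup p N ∧ x ∈ N := by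
  induction n using Nat.strong_induction_on with
  | _ n ih =>
  intro G _ _ hn p _ A B x hA hB hxA hxB hxp hmin
  by_cases hgen : ∃ g : G, A ⊔ B.map (MulAut.conj g).toMonoidHom = ⊤
  · obtain ⟨g, hg⟩ := hgen
    have hcent : ∀ y ∈ A, g⁻¹ * y * g ∈ B → ∀ z, z * y = y * z := by
      intro y hy hyB
      have : (⊤ : Subgroup G) ≤ Subgroup.centralizer {y} := by
        rw [← hg]
        refine sup_le ?_ ?_
        · intro a ha
          rw [Subgroup.mem_centralizer_singleton_iff]
          exact hA _ ha _ hy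
        · rintro _ ⟨b, hb, rfl⟩
          rw [Subgroup.mem_centralizer_singleton_iff]
          have := hB _ hb _ hyB
          simp only [MulEquiv.toMonoidHom_eq_coe, MonoidHom.coe_coe, MulAut.conj_apply]
          calc g * b * g⁻¹ * y = g * (b * (g⁻¹ * y * g)) * g⁻¹ := by group
            _ = _ := by rw [this]; group
      intro z
      have := this (Subgroup.mem_top z)
      exact (Subgroup.mem_centralizer_singleton_iff.1 this)
    have h1 : ∀ y ∈ A, g⁻¹ * y * g ∈ B → y ∈ B := by
      intro y hy hyB
      have := hcent y hy hyB g⁻¹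
      rw [this] at hyB
      simpa using hyB
    have hxc := hcent x hxA (hmin g h1 x hxA hxB)
    refine ⟨Subgroup.zpowers x, ⟨?_⟩, isPGroup_zpowers x hxp, Subgroup.mem_zpowers x⟩
    rintro _ ⟨k, rfl⟩ z
    refine ⟨k, ?_⟩
    have : Commute z (x ^ k) := Commute.zpow_right (hxc z) k
    simp only
    rw [this.eq]
    simp
  · push Not at hgen
    apply baer
    intro g
    set H := A ⊔ B.map (MulAut.conj g).toMonoidHom with hH
    have hAH : A ≤ H := le_sup_left
    have hlt : Nat.card H < n := by
      rw [← hn]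
      refine lt_of_le_of_ne (Subgroup.card_le_card_group H) fun h => hgen g ?_
      exact Subgroup.eq_top_of_card_eq H h
    have hgx : g * x * g⁻¹ ∈ H := (le_sup_right : _ ≤ H) ⟨x, hxB, by simp⟩
    obtain ⟨N, hN, hNp, hxN⟩ := ih _ hlt H rfl p (A.subgroupOf H) (B.subgroupOf H) ⟨x, hAH hxA⟩
      (fun a ha b hb => Subtype.ext (hA a ha b hb)) (fun a ha b hb => Subtype.ext (hB a ha b hb))
      hxA hxB ((Subgroup.orderOf_mk x _).trans hxp)
      (by
        intro h hh y hyA hyB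
        refine hmin (h : G) ?_ y hyA hyB
        intro z hz hzB
        exact hh ⟨z, hAH hz⟩ hz hzB)
    have hP2 : IsPGroup p (Subgroup.zpowers (⟨g * x * g⁻¹, hgx⟩ : H)) := by
      refine isPGroup_zpowers _ ((Subgroup.orderOf_mk _ _).trans ?_)
      rw [← hxp]
      exact orderOf_injective (MulAut.conj g).toMonoidHom (MulAut.conj g).injective x
    have hsup := hNp.to_sup_of_normal_left hP2
    refine ⟨(N ⊔ Subgroup.zpowers (⟨g * x * g⁻¹, hgx⟩ : H)).map H.subtype, hsup.map _,
      ⟨_, Subgroup.mem_sup_left hxN, rfl⟩,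
      ⟨_, Subgroup.mem_sup_right (Subgroup.mem_zpowers _), rfl⟩⟩


lemma card_eq_mul_relIndex {G : Type*} [Group G] (E K : Subgroup G) (h : E ≤ K) :
    Nat.card K = Nat.card E * E.relIndex K := by
  have := Subgroup.relIndex_mul_relIndex ⊥ E K bot_le h
  rw [Subgroup.relIndex_bot_left, Subgroup.relIndex_bot_left] at this
  exact this.symm

lemma card_sup_mul {G : Type*} [Group G] (A E : Subgroup G) [E.Normal] :
    Nat.card (A ⊔ E : Subgroup G) * Nat.card (A ⊓ E : Subgroup G) = Nat.card A * Nat.card E := by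
  rw [card_eq_mul_relIndex E (A ⊔ E) le_sup_right, card_eq_mul_relIndex (A ⊓ E) A inf_le_left,
    Subgroup.relIndex_sup_right, Subgroup.inf_relIndex_left]
  ring

lemma card_eq_mul_map {G : Type*} [Group G] (E K : Subgroup G) [E.Normal] (h : E ≤ K) :
    Nat.card K = Nat.card E * Nat.card (K.map (QuotientGroup.mk' E)) := by
  rw [card_eq_mul_relIndex E K h, ← Subgroup.relIndex_ker, QuotientGroup.ker_mk']

lemma quot_step {G : Type*} [Group G] [Finite G] (A E : Subgroup G) [E.Normal] [IsCyclic A]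
    (hAE : A ⊔ E ≠ ⊤)
    (hL : ∀ A' : Subgroup (G ⧸ E), IsCyclic A' → A' ≠ ⊤ →
      ∃ N ≤ A', N.Normal ∧ Nat.card A' ^ 2 < Nat.card (G ⧸ E) * Nat.card N) :
    ∃ M : Subgroup G, E ≤ M ∧ M ≤ A ⊔ E ∧ M.Normal ∧
      Nat.card (A ⊔ E : Subgroup G) ^ 2 < Nat.card G * Nat.card M := by
  have hmap : (A ⊔ E).map (QuotientGroup.mk' E) = A.map (QuotientGroup.mk' E) := by
    rw [Subgroup.map_sup]
    simp
  have hcomap : (A.map (QuotientGroup.mk' E)).comap (QuotientGroup.mk' E) = A ⊔ E := by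
    rw [Subgroup.comap_map_eq, QuotientGroup.ker_mk']
  have hsurj : Function.Surjective (QuotientGroup.mk' E) := QuotientGroup.mk'_surjective E
  obtain ⟨N, hNA, hN, hcard⟩ := hL (A.map (QuotientGroup.mk' E))
    (isCyclic_of_surjective _ ((QuotientGroup.mk' E).subgroupMap_surjective A)) (by
    intro h
    rw [h, Subgroup.comap_top] at hcomap
    exact hAE hcomap.symm)
  have hEN : E ≤ N.comap (QuotientGroup.mk' E) := by
    intro x hx
    have : QuotientGroup.mk' E x = 1 := (QuotientGroup.eq_one_iff x).2 hx
    rw [Subgroup.mem_comap, this]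
    exact one_mem N
  refine ⟨N.comap (QuotientGroup.mk' E), hEN, ?_, hN.comap _, ?_⟩
  · rw [← hcomap]
    exact Subgroup.comap_mono hNA
  · rw [card_eq_mul_map E (A ⊔ E) le_sup_right, card_eq_mul_map E _ hEN, hmap,
      Subgroup.map_comap_eq_self_of_surjective hsurj, E.card_eq_card_quotient_mul_card_subgroup]
    have : 0 < Nat.card E := Nat.card_pos
    nlinarith [Nat.mul_lt_mul_of_pos_left hcard (Nat.mul_pos this this)]

lemma inter_conj_ne_bot {G : Type*} [Group G] [Finite G] (A : Subgroup G) (hA : A ≠ ⊤)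
    (hcard : Nat.card G ≤ Nat.card A ^ 2) (g : G) :
    ∃ y ∈ A, g⁻¹ * y * g ∈ A ∧ y ≠ 1 := by
  by_contra hcon
  push Not at hcon
  have hinj : Function.Injective (fun ab : A × A => (ab.1 : G) * (g * ab.2 * g⁻¹)) := by
    rintro ⟨a, b⟩ ⟨c, d⟩ h
    simp only at h
    have h2 : (c : G)⁻¹ * a = g * (d * (b : G)⁻¹) * g⁻¹ := by
      rw [inv_mul_eq_iff_eq_mul]
      calc (a : G) = (a * (g * b * g⁻¹)) * (g * (b : G)⁻¹ * g⁻¹) := by group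
        _ = _ := by rw [h]; group
    have h3 := hcon ((c : G)⁻¹ * a) (mul_mem (inv_mem c.2) a.2) (by
      rw [h2]
      have : g⁻¹ * (g * (d * (b : G)⁻¹) * g⁻¹) * g = d * (b : G)⁻¹ := by group
      rw [this]
      exact mul_mem d.2 (inv_mem b.2))
    have h4 : d * (b : G)⁻¹ = 1 := by
      rw [h3] at h2
      have := h2.symm
      rwa [conj_eq_one_iff] at this
    ext
    · exact (inv_mul_eq_one.1 h3).symm
    · exact (mul_inv_eq_one.1 h4).symm
  have hbij : Function.Bijective (fun ab : A × A => (ab.1 : G) * (g * ab.2 * g⁻¹)) := by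
    rw [Nat.bijective_iff_injective_and_card]
    refine ⟨hinj, le_antisymm (Nat.card_le_card_of_injective _ hinj) ?_⟩
    rw [Nat.card_prod, ← sq]
    exact hcard
  obtain ⟨⟨a, b⟩, hab⟩ := hbij.2 g⁻¹
  simp only at hab
  have hg : g = (a : G)⁻¹ * (b : G)⁻¹ := by
    have : (a : G) * g * b = 1 := by
      calc (a : G) * g * b = (a * (g * b * g⁻¹)) * g := by group
        _ = 1 := by rw [hab]; group
    calc g = (a : G)⁻¹ * (a * g * b) * (b : G)⁻¹ := by group
      _ = _ := by rw [this]; group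
  have hgA : g ∈ A := hg ▸ mul_mem (inv_mem a.2) (inv_mem b.2)
  have hbot : A = ⊥ := by
    rw [Subgroup.eq_bot_iff_forall]
    intro y hy
    exact hcon y hy (mul_mem (mul_mem (inv_mem hgA) hy) hgA)
  subst hbot
  apply hA
  apply Subgroup.eq_top_of_card_eq
  have : 0 < Nat.card G := Nat.card_pos
  simp at hcard ⊢
  omega

lemma exists_normal_pgroup {G : Type u} [Group G] [Finite G] (A : Subgroup G) (hA : A ≠ ⊤)
    (hab : ∀ a ∈ A, ∀ b ∈ A, a * b = b * a) (hcard : Nat.card G ≤ Nat.card A ^ 2) :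
    ∃ p : ℕ, p.Prime ∧ ∃ N : Subgroup G, N.Normal ∧ IsPGroup p N ∧ N ≠ ⊥ := by
  let B : G → Subgroup G := fun g => A.map (MulAut.conj g).toMonoidHom
  have hB : ∀ g y, y ∈ B g ↔ g⁻¹ * y * g ∈ A := by
    intro g y
    constructor
    · rintro ⟨a, ha, rfl⟩
      simpa [mul_assoc] using ha
    · intro h
      exact ⟨_, h, by simp [mul_assoc]⟩
  obtain ⟨g, -, hg⟩ := Set.exists_min_image (Set.univ : Set G)
    (fun g => (A ∩ B g : Set G).ncard) (Set.toFinite _) ⟨1, trivial⟩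
  obtain ⟨y, hyA, hyB, hy1⟩ := inter_conj_ne_bot A hA hcard g
  have hy : y ∈ A ⊓ B g := ⟨hyA, (hB g y).2 hyB⟩
  have hne : Nat.card (A ⊓ B g : Subgroup G) ≠ 1 := by
    intro h
    rw [Subgroup.card_eq_one] at h
    rw [h] at hy
    exact hy1 hy
  obtain ⟨p, hp, hpd⟩ := Nat.exists_prime_and_dvd hne
  have : Fact p.Prime := ⟨hp⟩
  obtain ⟨x, hx⟩ := exists_prime_orderOf_dvd_card' p hpd
  rw [← Subgroup.orderOf_coe] at hx
  obtain ⟨N, hN, hNp, hxN⟩ := zenkov_aux (Nat.card G) G rfl p A (B g) x hab (by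
      rintro _ ⟨a, ha, rfl⟩ _ ⟨b, hb, rfl⟩
      rw [← map_mul, ← map_mul, hab a ha b hb]) x.2.1 x.2.2 hx (by
    intro h hh z hzA hzB
    have hsub : (A ∩ B (h * g) : Set G) ⊆ (A ∩ B g : Set G) := by
      rintro w ⟨hw1, hw2⟩
      refine ⟨hw1, hh w hw1 ?_⟩
      rw [SetLike.mem_coe, hB] at hw2
      rw [hB]
      simpa [mul_assoc] using hw2
    have heq := Set.eq_of_subset_of_ncard_le hsub (hg (h * g) trivial) (Set.toFinite _)
    have hz : z ∈ (A ∩ B g : Set G) := ⟨hzA, hzB⟩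
    rw [← heq] at hz
    have hz2 := hz.2
    rw [SetLike.mem_coe, hB] at hz2
    rw [hB]
    simpa [mul_assoc] using hz2)
  refine ⟨p, hp, N, hN, hNp, ?_⟩
  rintro rfl
  rw [Subgroup.mem_bot] at hxN
  rw [hxN, orderOf_one] at hx
  exact hp.one_lt.ne hx

lemma exists_min_normal {G : Type*} [Group G] [Finite G] (p : ℕ) (hp : p.Prime)
    (N : Subgroup G) (hN : N.Normal) (hNp : IsPGroup p N) (hne : N ≠ ⊥) :
    ∃ E : Subgroup G, E.Normal ∧ E ≠ ⊥ ∧ (∀ a ∈ E, ∀ b ∈ E, a * b = b * a) ∧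
      (∀ a ∈ E, a ^ p = 1) ∧ ∀ F : Subgroup G, F.Normal → F ≤ E → F ≠ ⊥ → F = E := by
  have : Fact p.Prime := ⟨hp⟩
  have hnt : Nontrivial N := (Subgroup.nontrivial_iff_ne_bot N).2 hne
  have hc := hNp.center_nontrivial
  obtain ⟨E, hE⟩ := Set.Finite.exists_minimal
    (s := {E : Subgroup G | E.Normal ∧ E ≠ ⊥ ∧ IsPGroup p E ∧ ∀ a ∈ E, ∀ b ∈ E, a * b = b * a})
    (Set.toFinite _) ⟨(Subgroup.center N).map N.subtype, by
      refine ⟨inferInstance, ?_, ?_, ?_⟩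
      · rw [Ne, Subgroup.map_eq_bot_iff_of_injective _ N.subtype_injective]
        exact (Subgroup.nontrivial_iff_ne_bot _).1 hc
      · exact (hNp.to_subgroup _).map _
      · rintro _ ⟨a, ha, rfl⟩ _ ⟨b, hb, rfl⟩
        rw [← map_mul, ← map_mul, Subgroup.mem_center_iff.1 hb a]⟩
  obtain ⟨⟨hEn, hEb, hEp, hEab⟩, hmin⟩ := hE
  have hmin' : ∀ F : Subgroup G, F.Normal → F ≤ E → F ≠ ⊥ → F = E := by
    intro F hF hFE hFb
    exact le_antisymm hFE (hmin ⟨hF, hFb, hEp.to_le hFE,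
      fun a ha b hb => hEab a (hFE ha) b (hFE hb)⟩ hFE)
  refine ⟨E, hEn, hEb, hEab, ?_, hmin'⟩
  let F : Subgroup G :=
    { carrier := {x | x ∈ E ∧ x ^ p = 1}
      one_mem' := ⟨one_mem E, one_pow p⟩
      mul_mem' := by
        rintro a b ⟨ha, ha'⟩ ⟨hb, hb'⟩
        refine ⟨mul_mem ha hb, ?_⟩
        rw [Commute.mul_pow (hEab a ha b hb), ha', hb', one_mul]
      inv_mem' := by
        rintro a ⟨ha, ha'⟩
        refine ⟨inv_mem ha, ?_⟩
        rw [inv_pow, ha', inv_one] }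
  have hF : F = E := by
    apply hmin' F
    · refine ⟨?_⟩
      rintro a ⟨ha, ha'⟩ g
      refine ⟨hEn.conj_mem a ha g, ?_⟩
      rw [conj_pow, ha', mul_one, mul_inv_cancel]
    · exact fun a ha => ha.1
    · have hnt : Nontrivial E := (Subgroup.nontrivial_iff_ne_bot E).2 hEb
      have hd : p ∣ Nat.card E := by
        obtain ⟨n, hn0, hn⟩ := hEp.nontrivial_iff_card.1 hnt
        rw [hn]
        exact dvd_pow_self p hn0.ne'
      obtain ⟨x, hx⟩ := exists_prime_orderOf_dvd_card' p hd
      intro hbot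
      have hxF : (x : G) ∈ F := ⟨x.2, by
        have := pow_orderOf_eq_one x
        rw [hx] at this
        exact_mod_cast this⟩
      rw [hbot, Subgroup.mem_bot] at hxF
      have hx1 : x = 1 := Subtype.ext hxF
      rw [hx1, orderOf_one] at hx
      exact hp.one_lt.ne hx
  intro a ha
  rw [← hF] at ha
  exact ha.2

lemma normal_of_sup_eq_top {G : Type*} [Group G] (A E F : Subgroup G) (h : A ⊔ E = ⊤)
    (hA : ∀ a ∈ A, ∀ f ∈ F, a * f * a⁻¹ ∈ F) (hE : ∀ a ∈ E, ∀ f ∈ F, a * f * a⁻¹ ∈ F) :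
    F.Normal := by
  rw [← Subgroup.normalizer_eq_top_iff, eq_top_iff, ← h]
  exact sup_le (Subgroup.le_normalizer_iff.2 hA) (Subgroup.le_normalizer_iff.2 hE)

lemma case_top {G : Type*} [Group G] [Finite G] (A E : Subgroup G) [hEn : E.Normal]
    (hab : ∀ a ∈ A, ∀ b ∈ A, a * b = b * a) (hEab : ∀ a ∈ E, ∀ b ∈ E, a * b = b * a)
    (hEb : E ≠ ⊥) (hmin : ∀ F : Subgroup G, F.Normal → F ≤ E → F ≠ ⊥ → F = E)
    (hcore : ∀ F : Subgroup G, F.Normal → F ≤ A → F = ⊥)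
    (htop : A ⊔ E = ⊤) (hcard : Nat.card G ≤ Nat.card A ^ 2) : False := by
  have hconj : ∀ a b : G, a * b = b * a → a * b * a⁻¹ = b := by
    intro a b h
    rw [h, mul_assoc, mul_inv_cancel, mul_one]
  have hinf : A ⊓ E = ⊥ := by
    refine hcore _ (normal_of_sup_eq_top A E _ htop ?_ ?_) inf_le_left
    · rintro a ha f hf
      rwa [hconj a f (hab a ha f hf.1)]
    · rintro a ha f hf
      rwa [hconj a f (hEab a ha f hf.2)]
  have hprod := card_sup_mul A E
  rw [htop, hinf, Subgroup.card_bot, mul_one, Subgroup.card_top] at hprod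
  have hApos : 0 < Nat.card A := Nat.card_pos
  have hle : Nat.card E ≤ Nat.card A := by
    rw [hprod, sq] at hcard
    exact Nat.le_of_mul_le_mul_left hcard hApos
  have hfaith : ∀ a ∈ A, (∀ e ∈ E, a * e = e * a) → a = 1 := by
    intro a ha hae
    have hz : Subgroup.zpowers a = ⊥ := by
      refine hcore _ (normal_of_sup_eq_top A E _ htop ?_ ?_) (by rwa [Subgroup.zpowers_le])
      · rintro b hb _ ⟨k, rfl⟩
        refine ⟨k, (hconj _ _ ?_).symm⟩
        exact Commute.zpow_right (hab b hb a ha) k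
      · rintro b hb _ ⟨k, rfl⟩
        refine ⟨k, (hconj _ _ ?_).symm⟩
        exact Commute.zpow_right (hae b hb).symm k
    exact Subgroup.zpowers_eq_bot.1 hz
  obtain ⟨⟨e, heE⟩, he1'⟩ := Subgroup.ne_bot_iff_exists_ne_one.1 hEb
  have he1 : e ≠ 1 := fun h => he1' (Subtype.ext h)
  have hfix : ∀ a ∈ A, a * e = e * a → a = 1 := by
    intro a ha hae
    have hF : E ⊓ Subgroup.centralizer {a} = E := by
      refine hmin _ (normal_of_sup_eq_top A E _ htop ?_ ?_) inf_le_left ?_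
      · rintro b hb f ⟨hf1, hf2⟩
        refine ⟨hEn.conj_mem f hf1 b, ?_⟩
        refine Subgroup.mem_centralizer_singleton_iff.2 ?_
        have h1 : Commute f a := Subgroup.mem_centralizer_singleton_iff.1 hf2
        have h2 : Commute b a := hab b hb a ha
        exact (h2.mul_left h1).mul_left h2.inv_left
      · rintro b hb f hf
        rwa [hconj b f (hEab b hb f hf.1)]
      · intro hbot
        have : e ∈ E ⊓ Subgroup.centralizer {a} :=
          ⟨heE, Subgroup.mem_centralizer_singleton_iff.2 hae.symm⟩
        rw [hbot] at this
        exact he1 this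
    apply hfaith a ha
    intro f hf
    rw [← hF] at hf
    exact (Subgroup.mem_centralizer_singleton_iff.1 hf.2).symm
  have hlt : Nat.card A < Nat.card E := by
    let f : A → E := fun a => ⟨a * e * (a : G)⁻¹, hEn.conj_mem e heE a⟩
    have hf : Function.Injective f := by
      intro a b h
      have h1 : (a : G) * e * (a : G)⁻¹ = b * e * (b : G)⁻¹ := congrArg Subtype.val h
      have h2 := hfix ((b : G)⁻¹ * a) (mul_mem (inv_mem b.2) a.2) (by
        calc (b : G)⁻¹ * a * e = (b : G)⁻¹ * (a * e * (a : G)⁻¹) * a := by group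
          _ = _ := by rw [h1]; group)
      exact Subtype.ext (inv_mul_eq_one.1 h2).symm
    refine lt_of_le_of_ne (Nat.card_le_card_of_injective f hf) ?_
    intro heq
    obtain ⟨a, ha⟩ := ((Nat.bijective_iff_injective_and_card f).2 ⟨hf, heq⟩).2 1
    have h1 : (a : G) * e * (a : G)⁻¹ = 1 := congrArg Subtype.val ha
    exact he1 (conj_eq_one_iff.1 h1)
  omega

lemma normal_of_le_cyclic {G : Type*} [Group G] (L Z : Subgroup G) [hZ : Z.Normal] [IsCyclic Z]
    (h : L ≤ Z) : L.Normal := by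
  obtain ⟨z, hz⟩ := IsCyclic.exists_generator (α := Z)
  refine ⟨?_⟩
  intro l hl g
  obtain ⟨j, hj⟩ := hz ⟨l, h hl⟩
  obtain ⟨k, hk⟩ := hz ⟨g * z * g⁻¹, hZ.conj_mem z z.2 g⟩
  have hj' : (z : G) ^ j = l := congrArg Subtype.val hj
  have hk' : (z : G) ^ k = g * z * g⁻¹ := congrArg Subtype.val hk
  have : g * l * g⁻¹ = l ^ k := by
    rw [← hj', ← conj_zpow, ← hk', ← zpow_mul, ← zpow_mul, mul_comm]
  rw [this]
  exact zpow_mem hl k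

lemma case_proper {G : Type*} [Group G] [Finite G] (A E M : Subgroup G) [IsCyclic A]
    [hEn : E.Normal] [hMn : M.Normal] (p : ℕ) (hp : p.Prime)
    (hEab : ∀ a ∈ E, ∀ b ∈ E, a * b = b * a) (hEp : ∀ a ∈ E, a ^ p = 1)
    (hEb : E ≠ ⊥) (hmin : ∀ F : Subgroup G, F.Normal → F ≤ E → F ≠ ⊥ → F = E)
    (hcore : ∀ F : Subgroup G, F.Normal → F ≤ A → F = ⊥)
    (hcard : Nat.card G ≤ Nat.card A ^ 2)
    (hEM : E ≤ M) (hMA : M ≤ A ⊔ E)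
    (hM : Nat.card (A ⊔ E : Subgroup G) ^ 2 < Nat.card G * Nat.card M)
    (hL : ∀ A' : Subgroup M, IsCyclic A' → A' ≠ ⊤ →
      ∃ N ≤ A', N.Normal ∧ Nat.card A' ^ 2 < Nat.card M * Nat.card N) : False := by
  have hab : ∀ a ∈ A, ∀ b ∈ A, a * b = b * a := by
    intro a ha b hb
    have : IsMulCommutative A := inferInstance
    exact congrArg Subtype.val (mul_comm' (⟨a, ha⟩ : A) ⟨b, hb⟩)
  set B := A ⊓ M with hB
  have hBM : B ≤ M := inf_le_right
  have hBcyc : IsCyclic B := Subgroup.isCyclic_of_le (inf_le_left : B ≤ A)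
  have hMBE : ∀ m ∈ M, ∃ b ∈ B, ∃ e ∈ E, b * e = m := by
    intro m hm
    obtain ⟨a, ha, e, he, rfl⟩ := Subgroup.mem_sup_of_normal_right.1 (hMA hm)
    refine ⟨a, ⟨ha, ?_⟩, e, he, rfl⟩
    have := mul_mem hm (inv_mem (hEM he))
    simpa using this
  have hsup : B ⊔ E = M := by
    apply le_antisymm (sup_le hBM hEM)
    intro m hm
    obtain ⟨b, hb, e, he, rfl⟩ := hMBE m hm
    exact Subgroup.mul_mem_sup hb he
  have hinf : B ⊓ E = A ⊓ E := by
    rw [hB, inf_assoc, inf_eq_right.2 hEM]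
  have hMB : Nat.card M < Nat.card B ^ 2 := by
    have h1 := card_sup_mul A E
    have h2 := card_sup_mul B E
    rw [hsup, hinf] at h2
    have h3 : Nat.card (A ⊔ E : Subgroup G) ^ 2 < Nat.card A ^ 2 * Nat.card M :=
      hM.trans_le (Nat.mul_le_mul_right _ hcard)
    generalize Nat.card (A ⊔ E : Subgroup G) = s at *
    generalize Nat.card (A ⊓ E : Subgroup G) = d at *
    have hA0 : 0 < Nat.card A := Nat.card_pos
    have hE0 : 0 < Nat.card E := Nat.card_pos
    have hM0 : 0 < Nat.card M := Nat.card_pos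
    generalize Nat.card A = a at *
    generalize Nat.card E = e at *
    generalize Nat.card M = m at *
    generalize Nat.card B = b at *
    have hd0 : 0 < d := by
      rcases Nat.eq_zero_or_pos d with h | h
      · subst h
        have := Nat.mul_pos hA0 hE0
        omega
      · exact h
    have h4 : e ^ 2 < m * d ^ 2 := by
      have : a ^ 2 * e ^ 2 < a ^ 2 * (m * d ^ 2) := by
        calc a ^ 2 * e ^ 2 = s ^ 2 * d ^ 2 := by rw [← mul_pow, ← h1, mul_pow]
          _ < a ^ 2 * m * d ^ 2 := Nat.mul_lt_mul_of_pos_right h3 (by positivity)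
          _ = _ := by ring
      exact Nat.lt_of_mul_lt_mul_left this
    have h5 : m * (m * d ^ 2) ≤ b ^ 2 * e ^ 2 := by
      rw [← mul_pow, ← h2]
      apply le_of_eq
      ring
    by_contra hcon
    push Not at hcon
    have h6 : b ^ 2 * e ^ 2 ≤ m * e ^ 2 := Nat.mul_le_mul_right _ hcon
    have h7 : m * e ^ 2 < m * (m * d ^ 2) := Nat.mul_lt_mul_of_pos_left h4 hM0
    omega
  have hBne : B.subgroupOf M ≠ ⊤ := by
    rw [Ne, Subgroup.subgroupOf_eq_top]
    intro h
    exact hEb (hcore E hEn (hEM.trans (h.trans inf_le_left)))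
  have hcB : Nat.card (B.subgroupOf M) = Nat.card B :=
    Nat.card_congr (Subgroup.subgroupOfEquivOfLe hBM).toEquiv
  obtain ⟨L', hL'B, hL'n, hL'c⟩ := hL (B.subgroupOf M)
    (isCyclic_of_surjective (Subgroup.subgroupOfEquivOfLe hBM).symm
      (Subgroup.subgroupOfEquivOfLe hBM).symm.surjective) hBne
  rw [hcB] at hL'c
  have hL'1 : L' ≠ ⊥ := by
    rintro rfl
    rw [Subgroup.card_bot, mul_one] at hL'c
    omega
  set L := L'.map M.subtype with hLdef
  have hLB : L ≤ B := by
    rintro _ ⟨l, hl, rfl⟩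
    exact hL'B hl
  have hLne : L ≠ ⊥ := by
    rwa [Ne, hLdef, Subgroup.map_eq_bot_iff_of_injective _ M.subtype_injective]
  have hLconj : ∀ m ∈ M, ∀ l ∈ L, m * l * m⁻¹ ∈ L := by
    rintro m hm _ ⟨l, hl, rfl⟩
    exact ⟨_, hL'n.conj_mem l hl ⟨m, hm⟩, rfl⟩
  set Z := M ⊓ Subgroup.centralizer (M : Set G) with hZ
  have hZn : Z.Normal := inferInstance
  have hZmem : ∀ z ∈ M, (∀ b ∈ B, b * z = z * b) → (∀ e ∈ E, e * z = z * e) → z ∈ Z := by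
    intro z hz h1 h2
    refine ⟨hz, ?_⟩
    refine Subgroup.mem_centralizer_iff.2 ?_
    intro m hm
    obtain ⟨b, hb, e, he, rfl⟩ := hMBE m hm
    exact Commute.mul_left (h1 b hb) (h2 e he)
  have hZcomm : ∀ z ∈ Z, ∀ m ∈ M, m * z = z * m := fun z hz m hm =>
    Subgroup.mem_centralizer_iff.1 hz.2 m hm
  by_cases hEZ : E ⊓ Z = ⊥
  ·
    have hLZ : L ≤ Z := by
      intro l hl
      refine hZmem l (hBM (hLB hl)) (fun b hb => hab b hb.1 l (hLB hl).1) ?_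
      intro e he
      have hc : e * l * e⁻¹ * l⁻¹ ∈ E ⊓ Z := by
        have hcE : e * l * e⁻¹ * l⁻¹ ∈ E := by
          have := mul_mem he (hEn.conj_mem _ (inv_mem he) l)
          simpa [mul_assoc] using this
        have hcL : e * l * e⁻¹ * l⁻¹ ∈ L := mul_mem (hLconj e (hEM he) l hl) (inv_mem hl)
        exact ⟨hcE, hZmem _ (hEM hcE) (fun b hb => hab b hb.1 _ (hLB hcL).1)
          (fun f hf => hEab f hf _ hcE)⟩
      rw [hEZ, Subgroup.mem_bot] at hc
      calc e * l = (e * l * e⁻¹ * l⁻¹) * (l * e) := by group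
        _ = l * e := by rw [hc, one_mul]
    have hmapc : IsCyclic (A.map (QuotientGroup.mk' E)) :=
      isCyclic_of_surjective _ ((QuotientGroup.mk' E).subgroupMap_surjective A)
    have hZcyc : IsCyclic Z := by
      let f : Z →* A.map (QuotientGroup.mk' E) :=
        ((QuotientGroup.mk' E).comp Z.subtype).codRestrict _ (by
          intro z
          obtain ⟨b, hb, e, he, hbe⟩ := hMBE z z.2.1
          refine ⟨b, hb.1, ?_⟩
          simp only [MonoidHom.comp_apply, Subgroup.subtype_apply, ← hbe, map_mul]
          have : QuotientGroup.mk' E e = 1 := (QuotientGroup.eq_one_iff e).2 he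
          rw [this, mul_one])
      refine isCyclic_of_injective f ((injective_iff_map_eq_one f).2 ?_)
      intro z hz
      have h1 : QuotientGroup.mk' E (z : G) = 1 := congrArg Subtype.val hz
      have h2 : (z : G) ∈ E ⊓ Z := ⟨(QuotientGroup.eq_one_iff _).1 h1, z.2⟩
      rw [hEZ, Subgroup.mem_bot] at h2
      exact Subtype.ext h2
    have hLn : L.Normal := normal_of_le_cyclic L Z hLZ
    exact hLne (hcore L hLn (hLB.trans inf_le_left))
  ·
    have hEZ' : E ≤ Z := by
      have := hmin (E ⊓ Z) inferInstance inf_le_left hEZ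
      exact inf_eq_left.1 this
    have hMpow : ∀ m ∈ M, ∃ b ∈ B, m ^ p = b ^ p := by
      intro m hm
      obtain ⟨b, hb, e, he, rfl⟩ := hMBE m hm
      refine ⟨b, hb, ?_⟩
      have : Commute b e := hZcomm e (hEZ' he) b (hBM hb)
      rw [this.mul_pow, hEp e he, mul_one]
    have hMab : ∀ m ∈ M, ∀ n ∈ M, m * n = n * m := by
      intro m hm n hn
      have hnZ : n ∈ Z := by
        obtain ⟨b, hb, e, he, rfl⟩ := hMBE n hn
        refine mul_mem (hZmem b (hBM hb) (fun c hc => hab c hc.1 b hb.1) ?_) (hEZ' he)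
        exact fun f hf => (hZcomm f (hEZ' hf) b (hBM hb)).symm
      exact hZcomm n hnZ m hm
    let F : Subgroup G :=
      { carrier := {x | ∃ m ∈ M, m ^ p = x}
        one_mem' := ⟨1, one_mem M, one_pow p⟩
        mul_mem' := by
          rintro _ _ ⟨m, hm, rfl⟩ ⟨n, hn, rfl⟩
          exact ⟨m * n, mul_mem hm hn, Commute.mul_pow (hMab m hm n hn) p⟩
        inv_mem' := by
          rintro _ ⟨m, hm, rfl⟩
          exact ⟨m⁻¹, inv_mem hm, inv_pow m p⟩ }
    have hF : F = ⊥ := by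
      apply hcore
      · refine ⟨?_⟩
        rintro _ ⟨m, hm, rfl⟩ g
        exact ⟨g * m * g⁻¹, hMn.conj_mem m hm g, conj_pow⟩
      · rintro _ ⟨m, hm, rfl⟩
        obtain ⟨b, hb, hbp⟩ := hMpow m hm
        rw [hbp]
        exact pow_mem hb.1 p
    have hMp : ∀ m ∈ M, m ^ p = 1 := by
      intro m hm
      have : m ^ p ∈ F := ⟨m, hm, rfl⟩
      rwa [hF, Subgroup.mem_bot] at this
    have : Fact p.Prime := ⟨hp⟩
    have hMpg : IsPGroup p M := fun m => ⟨1, Subtype.ext (by simpa using hMp m m.2)⟩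
    obtain ⟨k, hk⟩ := IsPGroup.iff_card.1 hMpg
    obtain ⟨j, hj⟩ := IsPGroup.iff_card.1 (hMpg.to_le hBM)
    have hj1 : j ≤ 1 := by
      obtain ⟨g, hg⟩ := IsCyclic.exists_ofOrder_eq_natCard (α := B)
      have h1 : orderOf g ∣ p := orderOf_dvd_of_pow_eq_one (Subtype.ext (by
        simpa using hMp g (hBM g.2)))
      rw [hg, hj] at h1
      have h2 : p ^ j ≤ p ^ 1 := by simpa using Nat.le_of_dvd hp.pos h1
      exact (Nat.pow_le_pow_iff_right hp.one_lt).1 h2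
    have hjk : j < k := by
      have hlt : Nat.card (B.subgroupOf M) < Nat.card M :=
        lt_of_le_of_ne (Subgroup.card_le_card_group _)
          fun h => hBne (Subgroup.eq_top_of_card_eq _ h)
      rw [hcB, hj, hk] at hlt
      exact (Nat.pow_lt_pow_iff_right hp.one_lt).1 hlt
    rw [hj, hk, ← pow_mul] at hMB
    have := (Nat.pow_lt_pow_iff_right hp.one_lt).1 hMB
    omega

theorem luc_aux (n : ℕ) : ∀ (G : Type u) [Group G] [Finite G], Nat.card G = n →
    ∀ A : Subgroup G, IsCyclic A → A ≠ ⊤ →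
      ∃ N ≤ A, N.Normal ∧ Nat.card A ^ 2 < Nat.card G * Nat.card N := by
  induction n using Nat.strong_induction_on with
  | _ n ih =>
  intro G _ _ hn A hA hAtop
  have hquot : ∀ E : Subgroup G, E.Normal → E ≠ ⊥ → Nat.card (G ⧸ E) < n := by
    intro E _ hE
    rw [← hn, E.card_eq_card_quotient_mul_card_subgroup]
    have h1 : 0 < Nat.card (G ⧸ E) := Nat.card_pos
    have h2 : 1 < Nat.card E := by
      rw [Subgroup.one_lt_card_iff_ne_bot]
      exact hE
    nlinarith
  by_cases hcore : ∃ F : Subgroup G, F.Normal ∧ F ≤ A ∧ F ≠ ⊥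
  · obtain ⟨F, hF, hFA, hFb⟩ := hcore
    obtain ⟨M, -, hM, hMn, hMc⟩ := quot_step A F (by rwa [sup_eq_left.2 hFA])
      (ih _ (hquot F hF hFb) (G ⧸ F) rfl)
    rw [sup_eq_left.2 hFA] at hM hMc
    exact ⟨M, hM, hMn, hMc⟩
  have hcore' : ∀ F : Subgroup G, F.Normal → F ≤ A → F = ⊥ := by
    intro F h1 h2
    by_contra h3
    exact hcore ⟨F, h1, h2, h3⟩
  by_cases hcard : Nat.card A ^ 2 < Nat.card G
  · exact ⟨⊥, bot_le, inferInstance, by simpa using hcard⟩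
  exfalso
  push Not at hcard
  have hab : ∀ a ∈ A, ∀ b ∈ A, a * b = b * a := by
    intro a ha b hb
    have : IsMulCommutative A := inferInstance
    exact congrArg Subtype.val (mul_comm' (⟨a, ha⟩ : A) ⟨b, hb⟩)
  obtain ⟨p, hp, N, hN, hNp, hNb⟩ := exists_normal_pgroup A hAtop hab hcard
  obtain ⟨E, hEn, hEb, hEab, hEp, hmin⟩ := exists_min_normal p hp N hN hNp hNb
  by_cases htop : A ⊔ E = ⊤
  · exact case_top A E hab hEab hEb hmin hcore' htop hcard
  obtain ⟨M, hEM, hMA, hMn, hMc⟩ := quot_step A E htop (ih _ (hquot E hEn hEb) (G ⧸ E) rfl)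
  have hMlt : Nat.card M < n := by
    rw [← hn]
    refine lt_of_le_of_ne (Subgroup.card_le_card_group M) fun h => htop ?_
    have := Subgroup.eq_top_of_card_eq M h
    rwa [this, top_le_iff] at hMA
  exact case_proper A E M p hp hEab hEp hEb hmin hcore' hcard hEM hMA hMc (ih _ hMlt M rfl)

end LucchiniAux

theorem lucchini (G : Type*) [Group G] [Finite G] (H : Subgroup G)
    (hH : IsCyclic H) (hne : H ≠ ⊥) (hcard : Nat.card G ≤ Nat.card H ^ 2) :
    ∃ K : Subgroup G, K ≤ H ∧ K ≠ ⊥ ∧ K.Normal := by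
  by_cases htop : H = ⊤
  · exact ⟨H, le_rfl, hne, htop ▸ inferInstance⟩
  obtain ⟨N, hNH, hN, hlt⟩ := LucchiniAux.luc_aux _ G rfl H hH htop
  refine ⟨N, hNH, ?_, hN⟩
  rintro rfl
  rw [Subgroup.card_bot, mul_one] at hlt
  omega
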